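/- Let Λ(θ) = −∫₀^θ log|2 sin t| dt be the Lobachevsky function. If α, β, γ are nonnegative real numbers with α + β + γ = π, then Λ(α) + Λ(β) + Λ(γ) ≤ 3·Λ(π/3), and equality holds if and only if α = β = γ = π/3. (Equivalently: the volume Λ(α)+Λ(β)+Λ(γ) of an ideal hyperbolic tetrahedron with dihedral angles α, β, γ attains its maximal value 3Λ(π/3) precisely for the regular ideal tetrahedron.) -/

import Mathlib

open MeasureTheory Real

/-- The Lobachevsky function `Λ(θ) = −∫₀^θ log|2 sin t| dt`. -/
noncomputable def lobachevsky (θ : ℝ) : ℝ :=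
  -(∫ t in (0:ℝ)..θ, Real.log |2 * Real.sin t|)

theorem intervalIntegrable_log_abs_two_mul_sin (a b : ℝ) :
    IntervalIntegrable (fun t ↦ log |2 * sin t|) volume a b := by
  simp only [log_abs]
  refine MeromorphicOn.intervalIntegrable_log fun x _ ↦ ?_
  have : AnalyticAt ℝ (fun t ↦ 2 * sin t) x := by fun_prop
  exact this.meromorphicAt

theorem continuous_lobachevsky : Continuous lobachevsky :=
  (intervalIntegral.continuous_primitive intervalIntegrable_log_abs_two_mul_sin 0).neg

theorem hasDerivAt_lobachevsky {θ : ℝ} (hθ : sin θ ≠ 0) :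
    HasDerivAt lobachevsky (-log |2 * sin θ|) θ := by
  refine (intervalIntegral.integral_hasDerivAt_right
    (intervalIntegrable_log_abs_two_mul_sin 0 θ) ?_ ?_).neg
  · exact (by fun_prop : Measurable fun t ↦ log |2 * sin t|).stronglyMeasurable
      |>.stronglyMeasurableAtFilter
  · exact ContinuousAt.log (by fun_prop) (by simpa using hθ)

theorem lobachevsky_add_le_of_le {a b : ℝ} (ha : 0 ≤ a) (hab : a ≤ b) (hπ : a + b ≤ π) :
    lobachevsky a + lobachevsky b ≤ 2 * lobachevsky ((a + b) / 2) := by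
  have hmono : MonotoneOn (fun x ↦ lobachevsky x + lobachevsky (a + b - x))
      (Set.Icc 0 ((a + b) / 2)) := by
    refine monotoneOn_of_hasDerivWithinAt_nonneg
      (f' := fun x ↦ -log |2 * sin x| + -(-log |2 * sin (a + b - x)|)) (convex_Icc _ _)
      (continuous_lobachevsky.add
        (continuous_lobachevsky.comp (by fun_prop))).continuousOn ?_ ?_
    · intro x hx
      rw [interior_Icc] at hx
      obtain ⟨hx₀, hx₁⟩ := hx
      have h₁ := sin_pos_of_pos_of_lt_pi hx₀ (by linarith)
      have h₂ : 0 < sin (a + b - x) := sin_pos_of_pos_of_lt_pi (by linarith) (by linarith)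
      exact ((hasDerivAt_lobachevsky h₁.ne').add
        ((hasDerivAt_lobachevsky h₂.ne').comp_const_sub (a + b) x)).hasDerivWithinAt
    · intro x hx
      rw [interior_Icc] at hx
      obtain ⟨hx₀, hx₁⟩ := hx
      have h₁ := sin_pos_of_pos_of_lt_pi hx₀ (by linarith)
      have h₂ : sin x ≤ sin (a + b - x) := by
        rw [← sub_nonneg, sin_sub_sin]
        have := sin_nonneg_of_nonneg_of_le_pi (x := (a + b - x - x) / 2)
          (by linarith) (by linarith)
        have := cos_nonneg_of_neg_pi_div_two_le_of_le (x := (a + b - x + x) / 2)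
          (by linarith) (by linarith)
        positivity
      rw [abs_of_pos (by linarith), abs_of_pos (by linarith)]
      linarith [log_le_log (by linarith) (mul_le_mul_of_nonneg_left h₂ zero_le_two)]
  have h := hmono (a := a) (b := (a + b) / 2) ⟨ha, by linarith⟩ ⟨by linarith, le_rfl⟩ (by linarith)
  simp only [add_sub_cancel_left, sub_half] at h
  linarith

/-- Midpoint concavity of the Lobachevsky function for pairs of angles of a triangle. -/
theorem lobachevsky_add_le {a b : ℝ} (ha : 0 ≤ a) (hb : 0 ≤ b) (hπ : a + b ≤ π) :
    lobachevsky a + lobachevsky b ≤ 2 * lobachevsky ((a + b) / 2) := by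
  rcases le_total a b with h | h
  · exact lobachevsky_add_le_of_le ha h hπ
  · simpa only [add_comm] using lobachevsky_add_le_of_le hb h (by linarith)

theorem hasDerivAt_lobachevsky_isosceles {x : ℝ} (hx₀ : 0 < x) (hx₁ : x < π) :
    HasDerivAt (fun x ↦ lobachevsky x + 2 * lobachevsky ((π - x) / 2))
      (-log (2 * sin (x / 2))) x := by
  have h₁ : 0 < sin x := sin_pos_of_pos_of_lt_pi hx₀ hx₁
  have h₂ : sin ((π - x) / 2) = cos (x / 2) := by rw [sub_div, sin_pi_div_two_sub]
  have h₃ : 0 < cos (x / 2) := cos_pos_of_mem_Ioo ⟨by linarith, by linarith⟩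
  have h₄ : 0 < sin (x / 2) := sin_pos_of_pos_of_lt_pi (by linarith) (by linarith)
  have h₅ : sin x = 2 * sin (x / 2) * cos (x / 2) := by rw [← sin_two_mul]; congr 1; ring
  have hd : HasDerivAt (fun x ↦ (π - x) / 2) (-1 / 2) x :=
    ((hasDerivAt_id x).const_sub π).div_const 2
  refine ((hasDerivAt_lobachevsky h₁.ne').add
    (((hasDerivAt_lobachevsky (h₂ ▸ h₃.ne')).comp x hd).const_mul 2)).congr_deriv ?_
  rw [h₂, abs_of_pos (by positivity), abs_of_pos (by positivity), h₅,
    show 2 * (2 * sin (x / 2) * cos (x / 2)) = 2 * sin (x / 2) * (2 * cos (x / 2)) by ring,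
    log_mul (by positivity) (by positivity)]
  ring

theorem lobachevsky_isosceles_lt {x : ℝ} (hx₀ : 0 ≤ x) (hx₁ : x ≤ π) (hx : x ≠ π / 3) :
    lobachevsky x + 2 * lobachevsky ((π - x) / 2) < 3 * lobachevsky (π / 3) := by
  have hcont : Continuous fun x ↦ lobachevsky x + 2 * lobachevsky ((π - x) / 2) :=
    continuous_lobachevsky.add
      (continuous_const.mul (continuous_lobachevsky.comp (by fun_prop)))
  have hmax : lobachevsky (π / 3) + 2 * lobachevsky ((π - π / 3) / 2) =
      3 * lobachevsky (π / 3) := by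
    rw [show (π - π / 3) / 2 = π / 3 by ring]
    ring
  rw [← hmax]
  have hπ := pi_pos
  rcases hx.lt_or_gt with h | h
  · refine strictMonoOn_of_hasDerivWithinAt_pos (convex_Icc 0 (π / 3)) hcont.continuousOn
      (f' := fun x ↦ -log (2 * sin (x / 2))) ?_ ?_ ⟨hx₀, h.le⟩ ⟨by positivity, le_rfl⟩ h <;>
      (intro y hy; rw [interior_Icc] at hy; obtain ⟨hy₀, hy₁⟩ := hy)
    · exact (hasDerivAt_lobachevsky_isosceles hy₀ (by linarith)).hasDerivWithinAt
    · have h₁ := sin_lt_sin_of_lt_of_le_pi_div_two (x := y / 2) (y := π / 6)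
        (by linarith) (by linarith) (by linarith)
      rw [sin_pi_div_six] at h₁
      have h₂ : 0 < sin (y / 2) := sin_pos_of_pos_of_lt_pi (by linarith) (by linarith)
      exact neg_pos.2 (log_neg (by positivity) (by linarith))
  · refine strictAntiOn_of_hasDerivWithinAt_neg (convex_Icc (π / 3) π) hcont.continuousOn
      (f' := fun x ↦ -log (2 * sin (x / 2))) ?_ ?_ ⟨le_rfl, by linarith⟩ ⟨h.le, hx₁⟩ h <;>
      (intro y hy; rw [interior_Icc] at hy; obtain ⟨hy₀, hy₁⟩ := hy)
    · exact (hasDerivAt_lobachevsky_isosceles (by linarith) hy₁).hasDerivWithinAt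
    · have h₁ := sin_lt_sin_of_lt_of_le_pi_div_two (x := π / 6) (y := y / 2)
        (by linarith) (by linarith) (by linarith)
      rw [sin_pi_div_six] at h₁
      exact neg_neg_of_pos (log_pos (by linarith))

theorem lobachevsky_sum_lt_of_ne {a b c : ℝ} (ha : 0 ≤ a) (hb : 0 ≤ b) (hc : 0 ≤ c)
    (hsum : a + b + c = π) (hne : c ≠ π / 3) :
    lobachevsky a + lobachevsky b + lobachevsky c < 3 * lobachevsky (π / 3) := by
  have h₁ := lobachevsky_add_le ha hb (by linarith)
  have h₂ := lobachevsky_isosceles_lt hc (by linarith) hne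
  rw [show a + b = π - c by linarith] at h₁
  linarith

/-- For nonnegative reals `α, β, γ` with `α + β + γ = π` (the dihedral angles of an
ideal hyperbolic tetrahedron), the volume `Λ(α) + Λ(β) + Λ(γ)` is at most `3·Λ(π/3)`,
with equality if and only if `α = β = γ = π/3` (the regular ideal tetrahedron). -/
theorem lobachevsky_sum_le_three_lobachevsky_pi_div_three
    (α β γ : ℝ) (hα : 0 ≤ α) (hβ : 0 ≤ β) (hγ : 0 ≤ γ)
    (hsum : α + β + γ = Real.pi) :
    lobachevsky α + lobachevsky β + lobachevsky γ ≤ 3 * lobachevsky (Real.pi / 3) ∧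
    (lobachevsky α + lobachevsky β + lobachevsky γ = 3 * lobachevsky (Real.pi / 3) ↔
      α = Real.pi / 3 ∧ β = Real.pi / 3 ∧ γ = Real.pi / 3) := by
  by_cases h : α = π / 3 ∧ β = π / 3 ∧ γ = π / 3
  · obtain ⟨rfl, rfl, rfl⟩ := h
    have : lobachevsky (π / 3) + lobachevsky (π / 3) + lobachevsky (π / 3) =
        3 * lobachevsky (π / 3) := by ring
    simp [this]
  · have hlt : lobachevsky α + lobachevsky β + lobachevsky γ < 3 * lobachevsky (π / 3) := by
      by_cases hγ' : γ = π / 3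
      · have hα' : α ≠ π / 3 := fun hα' ↦ h ⟨hα', by linarith, hγ'⟩
        linarith [lobachevsky_sum_lt_of_ne hβ hγ hα (by linarith) hα']
      · exact lobachevsky_sum_lt_of_ne hα hβ hγ hsum hγ'
    exact ⟨hlt.le, iff_of_false hlt.ne h⟩
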